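/- There is a group isomorphism H²(A ⋊_σ ℤ, Eˣ) ≅ H²(A,Eˣ)^σ × Hom(A,Eˣ)_σ; equivalently, there is a split short exact sequence 0 → H²(A,Eˣ)^σ → H²(A ⋊_σ ℤ, Eˣ) → Hom(A,Eˣ)_σ → 0. (This realizes the degenerate Hochschild–Serre short exact sequence 0 → H⁰(W, H²(Ḡ,Eˣ)) → H²(W ⋉ Ḡ, Eˣ) → H¹(W, H¹(Ḡ,Eˣ)) → 0 of Corollary 3.2 of the paper for W ≅ ℤ, using H¹(A,Eˣ) = Hom(A,Eˣ), the computation of H⁰ and H¹ of the infinite cyclic group as invariants and coinvariants, and the splitness established in Proposition 3.7; the splitting uses that Eˣ is divisible.) -/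

import Mathlib

/-! Basic setup: cocycle description of quasicharacter sheaves on étale
commutative group schemes, following the paper's stalk description. -/

section QCS

variable (A : Type) [AddCommGroup A] (M : Type) [CommGroup M]

/-- The 2-cocycle condition for a function `a : A × A → M` (trivial action). -/
def IsCocycle (a : A → A → M) : Prop :=
  ∀ x y z : A, a (x + y) z * a x y = a x (y + z) * a y z

/-- The coboundary of a function `d : A → M`. -/
def cobound (d : A → M) : A → A → M :=
  fun x y => d (x + y) * (d x)⁻¹ * (d y)⁻¹

/-- The group of 2-cocycles `Z²(A,M)`. -/
def Z2 : Subgroup (A → A → M) where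
  carrier := {a | IsCocycle A M a}
  one_mem' := by intro x y z; simp
  mul_mem' := by
    intro a b ha hb
    intro x y z
    simp only [Pi.mul_apply]
    rw [mul_mul_mul_comm, ha x y z, hb x y z, mul_mul_mul_comm]
  inv_mem' := by
    intro a ha
    intro x y z
    simp only [Pi.inv_apply]
    rw [← mul_inv, ← mul_inv, ha x y z]

lemma mem_Z2_iff {a : A → A → M} : a ∈ Z2 A M ↔ IsCocycle A M a := Iff.rfl

/-- The coboundary map, as a homomorphism. -/
def coboundHom : (A → M) →* (A → A → M) where
  toFun := cobound A M
  map_one' := by funext x y; simp [cobound]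
  map_mul' := by
    intro d e
    funext x y
    simp only [cobound, Pi.mul_apply, mul_inv]
    simp [mul_comm, mul_left_comm, mul_assoc]

/-- The group of 2-coboundaries `B²(A,M)`. -/
def B2 : Subgroup (A → A → M) := (coboundHom A M).range

/-- The second cohomology group `H²(A,M)` (trivial action). -/
abbrev H2 : Type := Z2 A M ⧸ (B2 A M).subgroupOf (Z2 A M)

variable (σ : A ≃+ A)

/-- The compatibility condition between a 2-cocycle `a` and a 1-cochain `b`
relative to the automorphism `σ`. -/
def IsCompat (a : A → A → M) (b : A → M) : Prop :=
  ∀ x y : A, a (σ x) (σ y) * (a x y)⁻¹ = b (x + y) * (b x)⁻¹ * (b y)⁻¹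

/-- The group `ZQ(A,σ,M)` of quasicharacter data. -/
def ZQ : Subgroup ((A → A → M) × (A → M)) where
  carrier := {p | IsCocycle A M p.1 ∧ IsCompat A M σ p.1 p.2}
  one_mem' := ⟨fun x y z => by simp, fun x y => by simp⟩
  mul_mem' := by
    rintro p q ⟨hp1, hp2⟩ ⟨hq1, hq2⟩
    refine ⟨mul_mem (show p.1 ∈ Z2 A M from hp1) (show q.1 ∈ Z2 A M from hq1), ?_⟩
    intro x y
    have key : (p.1 (σ x) (σ y) * (p.1 x y)⁻¹) * (q.1 (σ x) (σ y) * (q.1 x y)⁻¹)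
        = (p.2 (x + y) * (p.2 x)⁻¹ * (p.2 y)⁻¹) * (q.2 (x + y) * (q.2 x)⁻¹ * (q.2 y)⁻¹) := by
      rw [hp2 x y, hq2 x y]
    simpa [Prod.fst_mul, Prod.snd_mul, Pi.mul_apply, mul_inv, mul_comm, mul_left_comm,
      mul_assoc] using key
  inv_mem' := by
    rintro p ⟨hp1, hp2⟩
    refine ⟨inv_mem (show p.1 ∈ Z2 A M from hp1), ?_⟩
    intro x y
    have key := congrArg (·⁻¹) (hp2 x y)
    simpa [Prod.fst_inv, Prod.snd_inv, Pi.inv_apply, mul_inv, mul_comm, mul_left_comm,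
      mul_assoc] using key

lemma mem_ZQ_iff {p : (A → A → M) × (A → M)} :
    p ∈ ZQ A M σ ↔ IsCocycle A M p.1 ∧ IsCompat A M σ p.1 p.2 := Iff.rfl

/-- The map `d ↦ (x ↦ d(σ x)·d(x)⁻¹)`, as a homomorphism. -/
def sigmaDiff : (A → M) →* (A → M) where
  toFun d := fun x => d (σ x) * (d x)⁻¹
  map_one' := by funext x; simp
  map_mul' := by
    intro d e
    funext x
    simp only [Pi.mul_apply, mul_inv]
    simp [mul_comm, mul_left_comm, mul_assoc]

/-- The subgroup `BQ(A,σ,M)` of coboundary quasicharacter data. -/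
def BQ : Subgroup ((A → A → M) × (A → M)) :=
  ((coboundHom A M).prod (sigmaDiff A M σ)).range

/-- `HQ(A,σ,M)`: the group of quasicharacter data modulo coboundaries. -/
abbrev HQ : Type := ZQ A M σ ⧸ (BQ A M σ).subgroupOf (ZQ A M σ)

/-- The subgroup `A^σ` of fixed points of `σ`. -/
def fixedAdd : AddSubgroup A where
  carrier := {x | σ x = x}
  zero_mem' := by simp
  add_mem' := by
    intro a b ha hb
    simp only [Set.mem_setOf_eq] at *
    rw [map_add, ha, hb]
  neg_mem' := by
    intro a ha
    simp only [Set.mem_setOf_eq] at *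
    rw [map_neg, ha]

/-- The restriction of the 1-cochain part of a quasicharacter datum to `A^σ`,
as a character of `A^σ`. -/
def trZ (p : ZQ A M σ) : AddChar (fixedAdd A σ) M where
  toFun := fun x => (p : (A → A → M) × (A → M)).2 (x : A)
  map_zero_eq_one' := by
    have h := p.prop.2 (0 : A) 0
    simp at h
    simpa using h
  map_add_eq_mul' := by
    rintro ⟨x, hx⟩ ⟨y, hy⟩
    have hx' : σ x = x := hx
    have hy' : σ y = y := hy
    have h := p.prop.2 x y
    rw [hx', hy', mul_inv_cancel] at h
    have h2 : (p : (A → A → M) × (A → M)).2 (x + y)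
        * ((p : (A → A → M) × (A → M)).2 x)⁻¹
        * ((p : (A → A → M) × (A → M)).2 y)⁻¹ = 1 := h.symm
    rw [mul_inv_eq_one] at h2
    rw [mul_inv_eq_iff_eq_mul] at h2
    simpa [mul_comm] using h2

/-- The trace map `ZQ(A,σ,M) → Hom(A^σ, M)`, `(a,b) ↦ b|_{A^σ}`. -/
def trZHom : ZQ A M σ →* AddChar (fixedAdd A σ) M where
  toFun := trZ A M σ
  map_one' := by
    apply AddChar.ext
    intro x
    rfl
  map_mul' := by
    intro p q
    apply AddChar.ext
    intro x
    rfl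

lemma trZHom_trivial_on_BQ :
    (BQ A M σ).subgroupOf (ZQ A M σ) ≤ (trZHom A M σ).ker := by
  rintro ⟨p, hpZ⟩ hpB
  obtain ⟨d, hd⟩ := hpB
  have hd' : ((coboundHom A M).prod (sigmaDiff A M σ)) d = p := hd
  have hd2 : p.2 = fun x => d (σ x) * (d x)⁻¹ := by rw [← hd']; rfl
  apply AddChar.ext
  rintro ⟨x, hx⟩
  have hx' : σ x = x := hx
  show trZ A M σ ⟨p, hpZ⟩ _ = 1
  simp [trZ, hd2, hx']

/-- The trace-of-Frobenius homomorphism `Tr : HQ(A,σ,M) → Hom(A^σ,M)`. -/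
def TrHom : HQ A M σ →* AddChar (fixedAdd A σ) M :=
  QuotientGroup.lift _ (trZHom A M σ) (trZHom_trivial_on_BQ A M σ)

/-- The projection `ZQ(A,σ,M) → Z²(A,M)`, `(a,b) ↦ a`. -/
def zproj : ZQ A M σ →* Z2 A M where
  toFun := fun p => ⟨(p : (A → A → M) × (A → M)).1, p.prop.1⟩
  map_one' := rfl
  map_mul' := fun _ _ => rfl

lemma zproj_trivial_on_BQ :
    (BQ A M σ).subgroupOf (ZQ A M σ) ≤
      ((QuotientGroup.mk' ((B2 A M).subgroupOf (Z2 A M))).comp (zproj A M σ)).ker := by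
  rintro ⟨p, hpZ⟩ hpB
  obtain ⟨d, hd⟩ := hpB
  have hd' : ((coboundHom A M).prod (sigmaDiff A M σ)) d = p := hd
  have hd1 : p.1 = cobound A M d := by rw [← hd']; rfl
  simp only [MonoidHom.mem_ker, MonoidHom.comp_apply]
  rw [QuotientGroup.mk'_apply, QuotientGroup.eq_one_iff]
  show (zproj A M σ ⟨p, hpZ⟩ : A → A → M) ∈ B2 A M
  exact ⟨d, hd1.symm⟩

/-- The map `HQ(A,σ,M) → H²(A,M)` sending `[(a,b)]` to `[a]`. -/
def clsHom : HQ A M σ →* H2 A M :=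
  QuotientGroup.lift _ ((QuotientGroup.mk' ((B2 A M).subgroupOf (Z2 A M))).comp (zproj A M σ))
    (zproj_trivial_on_BQ A M σ)

/-- Precomposition with `σ × σ` on 2-cocycles. -/
def precompZ2 : Z2 A M →* Z2 A M where
  toFun := fun a => ⟨fun x y => (a : A → A → M) (σ x) (σ y), by
    intro x y z
    have := a.prop (σ x) (σ y) (σ z)
    simpa [map_add] using this⟩
  map_one' := rfl
  map_mul' := fun _ _ => rfl

lemma precompZ2_trivial : ((B2 A M).subgroupOf (Z2 A M)) ≤
    (((QuotientGroup.mk' ((B2 A M).subgroupOf (Z2 A M))).comp (precompZ2 A M σ))).ker := by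
  rintro ⟨a, haZ⟩ haB
  obtain ⟨d, hd⟩ := haB
  simp only [MonoidHom.mem_ker, MonoidHom.comp_apply]
  rw [QuotientGroup.mk'_apply, QuotientGroup.eq_one_iff]
  show (precompZ2 A M σ ⟨a, haZ⟩ : A → A → M) ∈ B2 A M
  refine ⟨fun x => d (σ x), ?_⟩
  have hd1 : a = cobound A M d := hd.symm
  funext x y
  show cobound A M (fun x => d (σ x)) x y = a (σ x) (σ y)
  rw [hd1]
  simp [cobound, map_add]

/-- The action of `σ` on `H²(A,M)`, `[a] ↦ [a ∘ (σ × σ)]`. -/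
def H2act : H2 A M →* H2 A M :=
  QuotientGroup.lift _
    ((QuotientGroup.mk' ((B2 A M).subgroupOf (Z2 A M))).comp (precompZ2 A M σ))
    (precompZ2_trivial A M σ)

/-- The subgroup `H²(A,M)^σ` of `σ`-fixed classes. -/
def H2fixed : Subgroup (H2 A M) where
  carrier := {c | H2act A M σ c = c}
  one_mem' := map_one _
  mul_mem' := by
    intro a b ha hb
    simp only [Set.mem_setOf_eq] at *
    rw [map_mul, ha, hb]
  inv_mem' := by
    intro a ha
    simp only [Set.mem_setOf_eq] at *
    rw [map_inv, ha]

end QCS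

/-- The action of `ℤ` on `A` (written multiplicatively) in which `n` acts by `σⁿ`. -/
def sdAct (A : Type) [AddCommGroup A] (σ : A ≃+ A) :
    Multiplicative ℤ →* MulAut (Multiplicative A) :=
  zpowersHom (MulAut (Multiplicative A)) (AddEquiv.toMultiplicative σ)

/-- The semidirect product `A ⋊_σ ℤ`. -/
abbrev sdGroup (A : Type) [AddCommGroup A] (σ : A ≃+ A) : Type :=
  SemidirectProduct (Multiplicative A) (Multiplicative ℤ) (sdAct A σ)

/-- The map `f ↦ f∘σ - f` on the character group `Hom(A, Eˣ)`,
written additively via `Additive Eˣ`. -/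
def augHom (E : Type) [Field E] (X : Type) [AddCommGroup X] (σ : X ≃+ X) :
    (X →+ Additive Eˣ) →+ (X →+ Additive Eˣ) :=
  AddMonoidHom.mk' (fun f => f.comp σ.toAddMonoidHom - f) (by
    intro f g
    ext x
    simp only [AddMonoidHom.sub_apply, AddMonoidHom.add_apply, AddMonoidHom.comp_apply]
    abel)

/-- The subgroup `{f∘σ - f : f ∈ Hom(A,Eˣ)}`; the quotient by it is the group of
coinvariants `Hom(A,Eˣ)_σ`. -/
def augSub (E : Type) [Field E] (X : Type) [AddCommGroup X] (σ : X ≃+ X) :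
    AddSubgroup (X →+ Additive Eˣ) := (augHom E X σ).range

section GroupCocycles

variable {G M : Type*} [Group G] [CommGroup M]

variable (G M) in
/-- The group of `M`-valued 2-cocycles on a group `G` acting trivially on `M`. -/
def twoCocycles : Subgroup (G → G → M) where
  carrier := {c | ∀ x y z, c (x * y) z * c x y = c x (y * z) * c y z}
  one_mem' := by intro x y z; simp
  mul_mem' := by
    intro a b ha hb x y z
    simp only [Pi.mul_apply]
    rw [mul_mul_mul_comm, ha x y z, hb x y z, mul_mul_mul_comm]
  inv_mem' := by
    intro a ha x y z
    simp only [Pi.inv_apply]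
    rw [← mul_inv, ← mul_inv, ha x y z]

lemma twoCocycles_one_left (c : twoCocycles G M) (x : G) : c.1 1 x = c.1 1 1 := by
  simpa using (c.2 1 1 x).symm

lemma twoCocycles_one_right (c : twoCocycles G M) (x : G) : c.1 x 1 = c.1 1 1 := by
  simpa using c.2 x 1 1

/-- The central extension of `G` by `M` attached to a 2-cocycle. -/
@[ext]
structure CentralExt (c : twoCocycles G M) where
  /-- The coordinate in the kernel. -/
  fib : M
  /-- The image in the base group. -/
  base : G

namespace CentralExt

variable {c : twoCocycles G M}

instance : Mul (CentralExt c) := ⟨fun u v => ⟨u.fib * v.fib * c.1 u.base v.base, u.base * v.base⟩⟩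

instance : One (CentralExt c) := ⟨⟨(c.1 1 1)⁻¹, 1⟩⟩

instance : Inv (CentralExt c) :=
  ⟨fun u => ⟨u.fib⁻¹ * (c.1 u.base⁻¹ u.base)⁻¹ * (c.1 1 1)⁻¹, u.base⁻¹⟩⟩

@[simp] lemma mul_fib (u v : CentralExt c) :
    (u * v).fib = u.fib * v.fib * c.1 u.base v.base := rfl

@[simp] lemma mul_base (u v : CentralExt c) : (u * v).base = u.base * v.base := rfl

@[simp] lemma one_fib : (1 : CentralExt c).fib = (c.1 1 1)⁻¹ := rfl

@[simp] lemma one_base : (1 : CentralExt c).base = 1 := rfl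

@[simp] lemma inv_fib (u : CentralExt c) :
    u⁻¹.fib = u.fib⁻¹ * (c.1 u.base⁻¹ u.base)⁻¹ * (c.1 1 1)⁻¹ := rfl

@[simp] lemma inv_base (u : CentralExt c) : u⁻¹.base = u.base⁻¹ := rfl

instance : Group (CentralExt c) :=
  Group.ofLeftAxioms
    (fun u v w => by
      ext
      · apply Additive.ofMul.injective
        have h := congrArg Additive.ofMul (c.2 u.base v.base w.base)
        simp only [mul_fib, mul_base, ofMul_mul] at h ⊢
        linear_combination (norm := abel) h
      · exact mul_assoc _ _ _)
    (fun u => by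
      ext
      · simp [twoCocycles_one_left]
      · simp)
    (fun u => by
      ext
      · apply Additive.ofMul.injective
        simp only [mul_fib, inv_fib, inv_base, one_fib, ofMul_mul, ofMul_inv]
        abel
      · simp)

variable (c) in
/-- The projection of a central extension to its base. -/
def proj : CentralExt c →* G where
  toFun := base
  map_one' := rfl
  map_mul' _ _ := rfl

/-- A cocycle whose central extension splits is a coboundary. -/
lemma exists_cobound_of_splitting (s : G →* CentralExt c)
    (hs : (proj c).comp s = MonoidHom.id G) :
    ∃ d : G → M, ∀ x y, c.1 x y = d (x * y) * (d x)⁻¹ * (d y)⁻¹ := by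
  have hb (x) : (s x).base = x := DFunLike.congr_fun hs x
  refine ⟨fun x => (s x).fib, fun x y => ?_⟩
  have h := congrArg fib (map_mul s x y)
  simp only [mul_fib, hb] at h
  apply Additive.ofMul.injective
  simp only [h, ofMul_mul, ofMul_inv]
  abel

end CentralExt

/-- Conjugating a central extension by a lift of `t` twists the cocycle by a coboundary. -/
lemma twoCocycles_conj (c : twoCocycles G M) {t x y x' y' : G} (hx : t * x = x' * t)
    (hy : t * y = y' * t) :
    c.1 x' y' * (c.1 x y)⁻¹ =
      (c.1 t (x * y) * (c.1 (x' * y') t)⁻¹) * (c.1 t x * (c.1 x' t)⁻¹)⁻¹ *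
        (c.1 t y * (c.1 y' t)⁻¹)⁻¹ := by
  have h₁ := congrArg Additive.ofMul (c.2 t x y)
  have h₂ := congrArg Additive.ofMul (c.2 x' t y)
  have h₃ := congrArg Additive.ofMul (c.2 x' y' t)
  apply Additive.ofMul.injective
  simp only [hx, hy, ofMul_mul, ofMul_inv] at h₁ h₂ h₃ ⊢
  linear_combination (norm := abel) h₁ - h₂ + h₃

end GroupCocycles

lemma mem_of_ofAdd_one_mem {K : Subgroup (Multiplicative ℤ)} (h : Multiplicative.ofAdd 1 ∈ K)
    (n : Multiplicative ℤ) : n ∈ K := by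
  have := K.zpow_mem h n.toAdd
  rwa [← ofAdd_zsmul, smul_eq_mul, mul_one, ofAdd_toAdd] at this

section Divisible

variable {A N : Type*} [AddCommGroup A] [AddCommGroup N] [DivisibleBy N ℤ]

lemma exists_extend_addSubgroup (B : AddSubgroup A) (f : B →+ N) :
    ∃ g : A →+ N, ∀ x : B, g x = f x := by
  obtain ⟨g, hg⟩ := (Module.Baer.of_divisible N).extension_property_addMonoidHom B.subtype
    B.subtype_injective f
  exact ⟨g, DFunLike.congr_fun hg⟩

lemma exists_eq_comp_sub (σ : A ≃+ A) (f : A →+ N) (hf : ∀ x, σ x = x → f x = 0) :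
    ∃ g : A →+ N, ∀ x, f x = g (σ x) - g x := by
  let D : A →+ A := σ.toAddMonoidHom - AddMonoidHom.id A
  have hD (x) : D x = σ x - x := rfl
  obtain ⟨g, hg⟩ := (Module.Baer.of_divisible N).extension_property_addMonoidHom
    (QuotientAddGroup.kerLift D) (QuotientAddGroup.kerLift_injective D)
    (QuotientAddGroup.lift D.ker f fun x hx => hf x (sub_eq_zero.mp hx))
  refine ⟨g, fun x => ?_⟩
  rw [← map_sub, ← hD]
  exact (DFunLike.congr_fun hg (x : A ⧸ D.ker)).symm

end Divisible

noncomputable instance (E : Type*) [Field E] [IsAlgClosed E] : DivisibleBy (Additive Eˣ) ℤ :=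
  letI : DivisibleBy (Additive Eˣ) ℕ :=
    divisibleByOfSMulRightSurj _ _ fun {n} hn x => by
      obtain ⟨z, hz⟩ := IsAlgClosed.exists_pow_nat_eq (x.toMul : E) (Nat.pos_of_ne_zero hn)
      have hz0 : z ≠ 0 := by
        rintro rfl
        rw [zero_pow hn] at hz
        exact x.toMul.ne_zero hz.symm
      exact ⟨Additive.ofMul (Units.mk0 z hz0),
        congrArg Additive.ofMul (Units.ext hz)⟩
  AddGroup.divisibleByIntOfDivisibleByNat _

section SemidirectCocycles

variable {A : Type} [AddCommGroup A] {M : Type} [CommGroup M] {σ : A ≃+ A}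

variable (σ) in
/-- The inclusion of `A` in `A ⋊_σ ℤ`. -/
def sdIncl (x : A) : sdGroup A σ := SemidirectProduct.inl (Multiplicative.ofAdd x)

variable (σ) in
/-- The generator of `ℤ` in `A ⋊_σ ℤ`. -/
def sdGen : sdGroup A σ := SemidirectProduct.inr (Multiplicative.ofAdd 1)

lemma sdIncl_add (x y : A) : sdIncl σ (x + y) = sdIncl σ x * sdIncl σ y :=
  map_mul SemidirectProduct.inl _ _

lemma sdAct_ofAdd_one (x : Multiplicative A) :
    sdAct A σ (Multiplicative.ofAdd 1) x = Multiplicative.ofAdd (σ x.toAdd) := by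
  simp [sdAct]

lemma sdGen_mul_sdIncl (x : A) : sdGen σ * sdIncl σ x = sdIncl σ (σ x) * sdGen σ := by
  have h := SemidirectProduct.inl_aut (φ := sdAct A σ) (Multiplicative.ofAdd 1)
    (Multiplicative.ofAdd x)
  rw [sdAct_ofAdd_one, toAdd_ofAdd, map_inv] at h
  exact (mul_inv_eq_iff_eq_mul.mp h.symm)

variable (M σ) in
/-- The quasicharacter datum attached to a 2-cocycle on `A ⋊_σ ℤ`. -/
def cocycleDatum : twoCocycles (sdGroup A σ) M →* ZQ A M σ where
  toFun c := ⟨(fun x y => c.1 (sdIncl σ x) (sdIncl σ y),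
      fun x => c.1 (sdGen σ) (sdIncl σ x) * (c.1 (sdIncl σ (σ x)) (sdGen σ))⁻¹), by
    refine ⟨fun x y z => ?_, fun x y => ?_⟩
    · simpa only [sdIncl_add] using c.2 (sdIncl σ x) (sdIncl σ y) (sdIncl σ z)
    · simpa only [sdIncl_add, map_add] using
        twoCocycles_conj c (sdGen_mul_sdIncl x) (sdGen_mul_sdIncl y)⟩
  map_one' := by
    ext <;> simp
  map_mul' c c' := by
    ext
    · rfl
    · simp only [Subgroup.coe_mul, Pi.mul_apply, Prod.snd_mul, mul_inv]
      exact mul_mul_mul_comm _ _ _ _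

lemma cocycleDatum_fst (c : twoCocycles (sdGroup A σ) M) (x y : A) :
    (cocycleDatum M σ c).1.1 x y = c.1 (sdIncl σ x) (sdIncl σ y) := rfl

lemma cocycleDatum_snd (c : twoCocycles (sdGroup A σ) M) (x : A) :
    (cocycleDatum M σ c).1.2 x =
      c.1 (sdGen σ) (sdIncl σ x) * (c.1 (sdIncl σ (σ x)) (sdGen σ))⁻¹ := rfl

lemma mem_BQ_iff {p : (A → A → M) × (A → M)} : p ∈ BQ A M σ ↔
    ∃ d : A → M, (∀ x y, p.1 x y = d (x + y) * (d x)⁻¹ * (d y)⁻¹) ∧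
      ∀ x, p.2 x = d (σ x) * (d x)⁻¹ := by
  constructor
  · rintro ⟨d, rfl⟩
    exact ⟨d, fun _ _ => rfl, fun _ => rfl⟩
  · rintro ⟨d, h₁, h₂⟩
    exact ⟨d, Prod.ext (funext₂ fun x y => (h₁ x y).symm) (funext fun x => (h₂ x).symm)⟩

lemma cocycleDatum_mem_BQ_of_cobound {c : twoCocycles (sdGroup A σ) M} {d : sdGroup A σ → M}
    (hd : ∀ g h, c.1 g h = d (g * h) * (d g)⁻¹ * (d h)⁻¹) :
    (cocycleDatum M σ c).1 ∈ BQ A M σ := by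
  refine mem_BQ_iff.mpr ⟨fun x => d (sdIncl σ x), fun x y => ?_, fun x => ?_⟩
  · simp only [cocycleDatum_fst, hd, sdIncl_add]
  · rw [cocycleDatum_snd, hd, hd, sdGen_mul_sdIncl]
    apply Additive.ofMul.injective
    simp only [ofMul_mul, ofMul_inv]
    abel

/-- A family of lifts of `A` which is compatible with a lift of the generator of `ℤ` extends to
`A ⋊_σ ℤ`. -/
lemma exists_sdLift {H : Type*} [Group H] (f : Multiplicative A →* H) (u : H)
    (hu : ∀ x : A, u * f (Multiplicative.ofAdd x) = f (Multiplicative.ofAdd (σ x)) * u) :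
    ∃ F : sdGroup A σ →* H, F.comp SemidirectProduct.inl = f ∧ F (sdGen σ) = u := by
  let K : Subgroup (Multiplicative ℤ) :=
    { carrier := {g | ∀ n, f (sdAct A σ g n) = MulAut.conj (zpowersHom H u g) (f n)}
      one_mem' := by intro n; simp
      mul_mem' := by
        intro g h hg hh n
        rw [map_mul, MulAut.mul_apply, hg, hh, map_mul, map_mul, MulAut.mul_apply]
      inv_mem' := by
        intro g hg n
        have h := hg ((sdAct A σ g)⁻¹ n)
        rw [MulAut.apply_inv_self] at h
        rw [map_inv, map_inv, map_inv, h, MulAut.inv_apply_self] }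
  have hK : Multiplicative.ofAdd 1 ∈ K := by
    intro n
    rw [sdAct_ofAdd_one]
    simp only [zpowersHom_apply, toAdd_ofAdd, zpow_one, MulAut.conj_apply]
    exact eq_mul_inv_of_mul_eq (hu n.toAdd).symm
  refine ⟨SemidirectProduct.lift f (zpowersHom H u) fun g =>
    MonoidHom.ext (mem_of_ofAdd_one_mem hK g), by simp, ?_⟩
  rw [sdGen, SemidirectProduct.lift_inr]
  simp

lemma exists_cobound_of_cocycleDatum_mem_BQ {c : twoCocycles (sdGroup A σ) M}
    (hc : (cocycleDatum M σ c).1 ∈ BQ A M σ) :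
    ∃ d : sdGroup A σ → M, ∀ g h, c.1 g h = d (g * h) * (d g)⁻¹ * (d h)⁻¹ := by
  obtain ⟨d, hd₁, hd₂⟩ := mem_BQ_iff.mp hc
  let f : Multiplicative A →* CentralExt c := MonoidHom.mk'
    (fun x => ⟨d x.toAdd, sdIncl σ x.toAdd⟩) fun x y => by
      ext1
      · have h := hd₁ x.toAdd y.toAdd
        rw [cocycleDatum_fst] at h
        simp only [CentralExt.mul_fib, h, toAdd_mul]
        apply Additive.ofMul.injective
        simp only [ofMul_mul, ofMul_inv]
        abel
      · exact sdIncl_add _ _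
  obtain ⟨F, hF₁, hF₂⟩ := exists_sdLift (σ := σ) f ⟨1, sdGen σ⟩ fun x => by
    ext1
    · have h := congrArg Additive.ofMul (hd₂ x)
      rw [cocycleDatum_snd] at h
      apply Additive.ofMul.injective
      simp only [f, MonoidHom.mk'_apply, CentralExt.mul_fib, toAdd_ofAdd, ofMul_mul, ofMul_inv,
        ofMul_one] at h ⊢
      linear_combination (norm := abel) h
    · exact sdGen_mul_sdIncl x
  refine CentralExt.exists_cobound_of_splitting F (SemidirectProduct.hom_ext ?_ ?_)
  · rw [MonoidHom.comp_assoc, hF₁]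
    rfl
  · ext
    · exact congrArg (fun u => u.base.left) hF₂
    · exact congrArg (fun u => u.base.right) hF₂

namespace CentralExt

/-- Translation of a central extension by an element of its kernel. -/
def scale {a : twoCocycles (Multiplicative A) M} (m : M) (u : CentralExt a) : CentralExt a :=
  ⟨m * u.fib, u.base⟩

/-- The cocycle on `Multiplicative A` underlying a quasicharacter datum. -/
def datumCocycle (p : ZQ A M σ) : twoCocycles (Multiplicative A) M :=
  ⟨fun x y => p.1.1 x.toAdd y.toAdd, fun x y z => p.2.1 x.toAdd y.toAdd z.toAdd⟩

/-- The automorphism of the central extension attached to a quasicharacter datum. -/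
def frobAut (p : ZQ A M σ) : MulAut (CentralExt (datumCocycle p)) where
  toFun u := ⟨u.fib * p.1.2 u.base.toAdd, Multiplicative.ofAdd (σ u.base.toAdd)⟩
  invFun u := ⟨u.fib * (p.1.2 (σ.symm u.base.toAdd))⁻¹, Multiplicative.ofAdd (σ.symm u.base.toAdd)⟩
  left_inv u := by simp
  right_inv u := by simp
  map_mul' u v := by
    ext1
    · have h := congrArg Additive.ofMul (p.2.2 u.base.toAdd v.base.toAdd)
      apply Additive.ofMul.injective
      simp only [mul_fib, mul_base, toAdd_mul, ofMul_mul, ofMul_inv] at h ⊢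
      simp only [datumCocycle, toAdd_ofAdd]
      linear_combination (norm := abel) -h
    · simp

/-- The powers of `frobAut p`. -/
def frobPow (p : ZQ A M σ) : Multiplicative ℤ →* MulAut (CentralExt (datumCocycle p)) :=
  zpowersHom _ (frobAut p)

lemma frobPow_scale_and_base (p : ZQ A M σ) (n : Multiplicative ℤ) :
    (∀ m u, frobPow p n (scale m u) = scale m (frobPow p n u)) ∧
      ∀ u, (frobPow p n u).base = sdAct A σ n u.base := by
  let K : Subgroup (Multiplicative ℤ) :=
    { carrier := {n | (∀ m u, frobPow p n (scale m u) = scale m (frobPow p n u)) ∧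
        ∀ u, (frobPow p n u).base = sdAct A σ n u.base}
      one_mem' := by simp
      mul_mem' := by
        rintro k l ⟨hk, hk'⟩ ⟨hl, hl'⟩
        refine ⟨fun m u => ?_, fun u => ?_⟩
        · rw [map_mul, MulAut.mul_apply, MulAut.mul_apply, hl, hk]
        · rw [map_mul, MulAut.mul_apply, hk', hl', map_mul, MulAut.mul_apply]
      inv_mem' := by
        rintro k ⟨hk, hk'⟩
        refine ⟨fun m u => ?_, fun u => ?_⟩
        · apply (frobPow p k).injective
          rw [hk, map_inv, MulAut.apply_inv_self, MulAut.apply_inv_self]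
        · apply (sdAct A σ k).injective
          rw [← hk', map_inv, map_inv, MulAut.apply_inv_self, MulAut.apply_inv_self] }
  refine mem_of_ofAdd_one_mem (K := K) ⟨fun m u => ?_, fun u => ?_⟩ n
  · simp [frobPow, frobAut, scale, mul_assoc]
  · rw [sdAct_ofAdd_one]
    simp [frobPow, frobAut]

/-- The scaling factor of the `n`-th power of `frobAut p` above `x`. -/
def frobFactor (p : ZQ A M σ) (n : Multiplicative ℤ) (x : Multiplicative A) : M :=
  (frobPow p n ⟨1, x⟩).fib

lemma frobPow_mk (p : ZQ A M σ) (n : Multiplicative ℤ) (m : M) (x : Multiplicative A) :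
    frobPow p n ⟨m, x⟩ = ⟨m * frobFactor p n x, sdAct A σ n x⟩ := by
  obtain ⟨h, h'⟩ := frobPow_scale_and_base p n
  have hs := h m ⟨1, x⟩
  simp only [scale, mul_one] at hs
  rw [hs]
  ext1
  · rfl
  · exact h' _

lemma frobFactor_mul (p : ZQ A M σ) (k l : Multiplicative ℤ) (x : Multiplicative A) :
    frobFactor p (k * l) x = frobFactor p k (sdAct A σ l x) * frobFactor p l x := by
  have h : frobPow p (k * l) ⟨1, x⟩ = frobPow p k (frobPow p l ⟨1, x⟩) := by
    rw [map_mul, MulAut.mul_apply]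
  simp only [frobPow_mk, one_mul] at h
  exact (congrArg fib h).trans (mul_comm _ _)

lemma frobFactor_compat (p : ZQ A M σ) (k : Multiplicative ℤ) (x y : Multiplicative A) :
    frobFactor p k x * frobFactor p k y * (datumCocycle p).1 (sdAct A σ k x) (sdAct A σ k y) =
      (datumCocycle p).1 x y * frobFactor p k (x * y) := by
  have h := congrArg fib (map_mul (frobPow p k) ⟨1, x⟩ ⟨1, y⟩)
  have h' : (⟨1, x⟩ * ⟨1, y⟩ : CentralExt (datumCocycle p)) =
      ⟨(datumCocycle p).1 x y, x * y⟩ := by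
    ext1 <;> simp
  simp only [h', frobPow_mk, mul_fib, one_mul] at h
  exact h.symm

lemma frobFactor_one_left (p : ZQ A M σ) (x : Multiplicative A) : frobFactor p 1 x = 1 := by
  simp [frobFactor]

lemma frobFactor_ofAdd_one (p : ZQ A M σ) (x : Multiplicative A) :
    frobFactor p (Multiplicative.ofAdd 1) x = p.1.2 x.toAdd := by
  simp [frobFactor, frobPow, frobAut]

/-- The 2-cocycle on `A ⋊_σ ℤ` attached to a quasicharacter datum. -/
def sdCocycle (p : ZQ A M σ) : twoCocycles (sdGroup A σ) M where
  val g h := (datumCocycle p).1 g.left (sdAct A σ g.right h.left) * frobFactor p g.right h.left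
  property g h k := by
    have h₁ := congrArg Additive.ofMul ((datumCocycle p).2 g.left (sdAct A σ g.right h.left)
      (sdAct A σ g.right (sdAct A σ h.right k.left)))
    have h₂ := congrArg Additive.ofMul
      (frobFactor_compat p g.right h.left (sdAct A σ h.right k.left))
    have h₃ := congrArg Additive.ofMul (frobFactor_mul p g.right h.right k.left)
    apply Additive.ofMul.injective
    simp only [SemidirectProduct.mul_left, SemidirectProduct.mul_right, map_mul,
      MulAut.mul_apply, ofMul_mul] at h₁ h₂ h₃ ⊢
    linear_combination (norm := abel) h₁ + h₂ + h₃

end CentralExt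

open CentralExt in
lemma cocycleDatum_sdCocycle (p : ZQ A M σ) : cocycleDatum M σ (sdCocycle p) = p := by
  have h₀ (x : Multiplicative A) : (datumCocycle p).1 1 x = (datumCocycle p).1 1 1 :=
    twoCocycles_one_left _ x
  have h₁ (x : Multiplicative A) : (datumCocycle p).1 x 1 = (datumCocycle p).1 1 1 :=
    twoCocycles_one_right _ x
  ext x
  · rename_i y
    rw [cocycleDatum_fst]
    simp [sdCocycle, sdIncl, frobFactor_one_left, datumCocycle]
  · rw [cocycleDatum_snd]
    simp [sdCocycle, sdIncl, sdGen, frobFactor_one_left, frobFactor_ofAdd_one, h₀, h₁]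

lemma cocycleDatum_surjective : Function.Surjective (cocycleDatum M σ) :=
  fun p => ⟨_, cocycleDatum_sdCocycle p⟩

end SemidirectCocycles

/-- A surjective homomorphism with kernel `S` identifies its target with the quotient by `S`. -/
noncomputable def quotientEquivOfKerEq {B C : Type*} [AddCommGroup B] [AddCommGroup C]
    {f : B →+ C} (hf : Function.Surjective f) {S : AddSubgroup B} (hS : f.ker = S) : B ⧸ S ≃+ C :=
  (QuotientAddGroup.quotientAddEquivOfEq hS.symm).trans
    (QuotientAddGroup.quotientKerEquivOfSurjective f hf)

section Splitting

variable {A : Type} [AddCommGroup A] {M : Type} [CommGroup M] {σ : A ≃+ A}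

lemma clsHom_mem_H2fixed (q : HQ A M σ) : clsHom A M σ q ∈ H2fixed A M σ := by
  induction q using QuotientGroup.induction_on with
  | H p =>
    refine QuotientGroup.eq.mpr ⟨fun x => (p.1.2 x)⁻¹, ?_⟩
    funext x y
    have h := congrArg Additive.ofMul (p.2.2 x y)
    apply Additive.ofMul.injective
    change Additive.ofMul ((p.1.2 (x + y))⁻¹ * ((p.1.2 x)⁻¹)⁻¹ * ((p.1.2 y)⁻¹)⁻¹) =
      Additive.ofMul ((p.1.1 (σ x) (σ y))⁻¹ * p.1.1 x y)
    simp only [ofMul_mul, ofMul_inv] at h ⊢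
    linear_combination (norm := abel) h

variable (A M σ) in
/-- The class and the trace of Frobenius of a quasicharacter datum. -/
def clsTrHom : HQ A M σ →* H2fixed A M σ × AddChar (fixedAdd A σ) M :=
  ((clsHom A M σ).codRestrict (H2fixed A M σ) clsHom_mem_H2fixed).prod (TrHom A M σ)

variable [DivisibleBy (Additive M) ℤ]

lemma clsTrHom_injective : Function.Injective (clsTrHom A M σ) := by
  refine (injective_iff_map_eq_one _).mpr fun q hq => ?_
  induction q using QuotientGroup.induction_on with
  | H p =>
    have h₁ : clsHom A M σ p = 1 := congrArg (fun w => (w.1 : H2 A M)) hq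
    have h₂ : trZ A M σ p = 1 := congrArg Prod.snd hq
    obtain ⟨d, hd⟩ := (QuotientGroup.eq_one_iff _).mp h₁
    have hd (x y) : p.1.1 x y = d (x + y) * (d x)⁻¹ * (d y)⁻¹ := (congrFun₂ hd x y).symm
    let f : A →+ Additive M := AddMonoidHom.mk'
      (fun x => Additive.ofMul (p.1.2 x * (d (σ x) * (d x)⁻¹)⁻¹)) fun x y => by
        have h := congrArg Additive.ofMul (p.2.2 x y)
        simp only [hd, map_add, ofMul_mul, ofMul_inv] at h ⊢
        linear_combination (norm := abel) -h
    have hf (x) : f x = Additive.ofMul (p.1.2 x * (d (σ x) * (d x)⁻¹)⁻¹) := rfl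
    obtain ⟨g, hg⟩ := exists_eq_comp_sub σ f fun x hx => by
      have h : p.1.2 x = 1 := DFunLike.congr_fun h₂ (⟨x, hx⟩ : fixedAdd A σ)
      simp [hf, hx, h]
    refine (QuotientGroup.eq_one_iff _).mpr (mem_BQ_iff.mpr
      ⟨fun x => d x * (g x).toMul, fun x y => ?_, fun x => ?_⟩)
    · change p.1.1 x y = _
      apply Additive.ofMul.injective
      simp only [hd, map_add, toMul_add, ofMul_mul, ofMul_inv, ofMul_toMul]
      abel
    · have h := hg x
      change p.1.2 x = _
      apply Additive.ofMul.injective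
      simp only [hf, ofMul_mul, ofMul_inv, ofMul_toMul] at h ⊢
      linear_combination (norm := abel) h

lemma clsTrHom_surjective : Function.Surjective (clsTrHom A M σ) := by
  rintro ⟨⟨q, hq⟩, χ⟩
  induction q using QuotientGroup.induction_on with
  | H a =>
    obtain ⟨b, hb⟩ := QuotientGroup.eq.mp hq
    have hb (x y) : b (x + y) * (b x)⁻¹ * (b y)⁻¹ = (a.1 (σ x) (σ y))⁻¹ * a.1 x y :=
      congrFun₂ hb x y
    have hb' : IsCompat A M σ a.1 (fun x => (b x)⁻¹) := fun x y => by
      have h := congrArg Additive.ofMul (hb x y)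
      apply Additive.ofMul.injective
      simp only [ofMul_mul, ofMul_inv] at h ⊢
      linear_combination (norm := abel) h
    let p : ZQ A M σ := ⟨(a.1, fun x => (b x)⁻¹), a.2, hb'⟩
    obtain ⟨g, hg⟩ := exists_extend_addSubgroup (fixedAdd A σ)
      (χ / trZ A M σ p).toAddMonoidHom
    let r : ZQ A M σ := ⟨(1, fun x => (g x).toMul), fun x y z => by simp, fun x y => by simp⟩
    refine ⟨((p * r : ZQ A M σ) : HQ A M σ), Prod.ext (Subtype.ext ?_) ?_⟩
    · change (QuotientGroup.mk (zproj A M σ (p * r)) : H2 A M) = _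
      congr 1
      exact Subtype.ext (mul_one _)
    · ext x
      change trZ A M σ p x * (g x).toMul = χ x
      rw [hg]
      change trZ A M σ p x * (χ / trZ A M σ p) x = χ x
      rw [AddChar.div_apply', mul_div_cancel]

variable (A M σ) in
/-- The splitting of `HQ(A,σ,M)` given by the trace of Frobenius. -/
noncomputable def clsTrEquiv : HQ A M σ ≃* H2fixed A M σ × AddChar (fixedAdd A σ) M :=
  MulEquiv.ofBijective (clsTrHom A M σ) ⟨clsTrHom_injective, clsTrHom_surjective⟩

variable (A M σ) in
/-- Restriction of characters from `A` to `A^σ`. -/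
def restrictFixed : (A →+ Additive M) →+ (fixedAdd A σ →+ Additive M) where
  toFun f := f.comp (fixedAdd A σ).subtype
  map_zero' := rfl
  map_add' _ _ := rfl

lemma restrictFixed_surjective : Function.Surjective (restrictFixed A M σ) := fun χ => by
  obtain ⟨g, hg⟩ := exists_extend_addSubgroup (fixedAdd A σ) χ
  exact ⟨g, AddMonoidHom.ext hg⟩

lemma restrictFixed_ker (E : Type) [Field E] [IsAlgClosed E] :
    (restrictFixed A Eˣ σ).ker = augSub E A σ := by
  ext f
  constructor
  · intro hf
    obtain ⟨g, hg⟩ := exists_eq_comp_sub σ f fun x hx =>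
      DFunLike.congr_fun hf (⟨x, hx⟩ : fixedAdd A σ)
    exact ⟨g, AddMonoidHom.ext fun x => (hg x).symm⟩
  · rintro ⟨g, rfl⟩
    refine AddMonoidHom.ext fun x => ?_
    have hx : σ x = x := x.2
    change g (σ x) - g x = 0
    rw [hx, sub_self]

/-- Multiplicative-valued additive characters as additive homomorphisms. -/
def addCharEquiv (B : Type*) [AddCommGroup B] (M : Type*) [CommGroup M] :
    Additive (AddChar B M) ≃+ (B →+ Additive M) where
  toEquiv := Additive.toMul.trans AddChar.toAddMonoidHomEquiv
  map_add' _ _ := rfl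

variable (A σ) in
/-- Coinvariant characters of `A` are characters of `A^σ`. -/
noncomputable def coinvariantsEquiv (E : Type) [Field E] [IsAlgClosed E] :
    ((A →+ Additive Eˣ) ⧸ augSub E A σ) ≃+ (fixedAdd A σ →+ Additive Eˣ) :=
  quotientEquivOfKerEq restrictFixed_surjective (restrictFixed_ker E)

end Splitting

section Comparison

variable {A : Type} [AddCommGroup A] {M : Type} [CommGroup M] {σ : A ≃+ A}

variable (M) in
/-- Inhomogeneous 2-cocycles with trivial coefficients as multiplicative 2-cocycles. -/
def toTwoCocycles (G : Type) [Group G] :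
    groupCohomology.cocycles₂ (Rep.trivial ℤ G (Additive M)) →+ Additive (twoCocycles G M) where
  toFun c := Additive.ofMul ⟨fun g h => Additive.toMul (c (g, h)), fun x y z =>
    ((groupCohomology.mem_cocycles₂_iff _).mp c.2 x y z).trans (add_comm _ _)⟩
  map_zero' := rfl
  map_add' _ _ := rfl

lemma toTwoCocycles_surjective (G : Type) [Group G] :
    Function.Surjective (toTwoCocycles M G) := fun c =>
  ⟨⟨fun g => Additive.ofMul (c.toMul.1 g.1 g.2), (groupCohomology.mem_cocycles₂_iff _).mpr
    fun x y z => (c.toMul.2 x y z).trans (mul_comm _ _)⟩, rfl⟩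

lemma mem_coboundaries₂_trivial_iff {G : Type} [Group G]
    (c : groupCohomology.cocycles₂ (Rep.trivial ℤ G (Additive M))) :
    ⇑c ∈ groupCohomology.coboundaries₂ (Rep.trivial ℤ G (Additive M)) ↔
      ∃ d : G → M, ∀ g h, (toTwoCocycles M G c).toMul.1 g h = d (g * h) * (d g)⁻¹ * (d h)⁻¹ := by
  constructor
  · rintro ⟨d, hd⟩
    let d' : G → M := fun g => Additive.toMul (d g : Additive M)
    refine ⟨fun g => (d' g)⁻¹, fun g h => ?_⟩
    have hc : (toTwoCocycles M G c).toMul.1 g h = d' h / d' (g * h) * d' g :=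
      (congrFun hd (g, h)).symm
    apply Additive.ofMul.injective
    simp only [hc, ofMul_mul, ofMul_inv, ofMul_div]
    abel
  · rintro ⟨d, hd⟩
    let d' : G → Additive M := fun g => -Additive.ofMul (d g)
    refine ⟨d', funext fun ⟨g, h⟩ => ?_⟩
    change d' h - d' (g * h) + d' g = Additive.ofMul ((toTwoCocycles M G c).toMul.1 g h)
    simp only [hd, d', ofMul_mul, ofMul_inv]
    abel

variable (M σ) in
/-- The class in `HQ(A,σ,M)` of an inhomogeneous 2-cocycle on `A ⋊_σ ℤ`. -/
def cocyclesToHQ : groupCohomology.cocycles₂ (Rep.trivial ℤ (sdGroup A σ) (Additive M)) →+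
    Additive (HQ A M σ) :=
  (MonoidHom.toAdditive ((QuotientGroup.mk' _).comp (cocycleDatum M σ))).comp
    (toTwoCocycles M (sdGroup A σ))

lemma cocyclesToHQ_surjective : Function.Surjective (cocyclesToHQ M σ) :=
  ((QuotientGroup.mk'_surjective _).comp cocycleDatum_surjective).comp
    (toTwoCocycles_surjective _)

lemma cocyclesToHQ_eq_zero_iff
    (c : groupCohomology.cocycles₂ (Rep.trivial ℤ (sdGroup A σ) (Additive M))) :
    cocyclesToHQ M σ c = 0 ↔
      ⇑c ∈ groupCohomology.coboundaries₂ (Rep.trivial ℤ (sdGroup A σ) (Additive M)) := by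
  rw [mem_coboundaries₂_trivial_iff]
  refine Iff.trans (QuotientGroup.eq_one_iff (cocycleDatum M σ _)) ⟨fun h => ?_, ?_⟩
  · exact exists_cobound_of_cocycleDatum_mem_BQ h
  · rintro ⟨d, hd⟩
    exact cocycleDatum_mem_BQ_of_cobound hd

variable (M σ) in
/-- `H²(A ⋊_σ ℤ, M)` is the group of quasicharacter data modulo coboundaries. -/
noncomputable def groupCohomologyTwoEquivHQ :
    groupCohomology (Rep.trivial ℤ (sdGroup A σ) (Additive M)) 2 ≃+ Additive (HQ A M σ) :=
  let π := (groupCohomology.H2π (Rep.trivial ℤ (sdGroup A σ) (Additive M))).hom.toAddMonoidHom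
  have hπ : Function.Surjective π := (ModuleCat.epi_iff_surjective _).mp inferInstance
  have hker : π.ker = (cocyclesToHQ M σ).ker := AddSubgroup.ext fun c =>
    (groupCohomology.H2π_eq_zero_iff c).trans (cocyclesToHQ_eq_zero_iff c).symm
  (quotientEquivOfKerEq hπ hker).symm.trans
    (QuotientAddGroup.quotientKerEquivOfSurjective _ cocyclesToHQ_surjective)

end Comparison

/-- There is a group isomorphism
`H²(A ⋊_σ ℤ, Eˣ) ≅ H²(A,Eˣ)^σ × Hom(A,Eˣ)_σ`; equivalently, the degenerate
Hochschild–Serre short exact sequence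
`0 → H²(A,Eˣ)^σ → H²(A ⋊_σ ℤ, Eˣ) → Hom(A,Eˣ)_σ → 0` splits. -/
theorem H2_of_semidirect_product_iso_fixed_prod_coinvariants
    (E : Type) [Field E] [IsAlgClosed E] [CharZero E]
    (A : Type) [AddCommGroup A] (σ : A ≃+ A) :
    Nonempty ((groupCohomology (Rep.trivial ℤ (sdGroup A σ) (Additive Eˣ)) 2) ≃+
      (Additive (H2fixed A Eˣ σ) × ((A →+ Additive Eˣ) ⧸ augSub E A σ))) := by
  let e₁ : Additive (HQ A Eˣ σ) ≃+ Additive (H2fixed A Eˣ σ × AddChar (fixedAdd A σ) Eˣ) :=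
    MulEquiv.toAdditive (G := HQ A Eˣ σ) (H := H2fixed A Eˣ σ × AddChar (fixedAdd A σ) Eˣ)
      (clsTrEquiv A Eˣ σ)
  let e₂ : Additive (H2fixed A Eˣ σ × AddChar (fixedAdd A σ) Eˣ) ≃+
      Additive (H2fixed A Eˣ σ) × Additive (AddChar (fixedAdd A σ) Eˣ) :=
    AddEquiv.prodAdditive _ _
  let e₃ : Additive (AddChar (fixedAdd A σ) Eˣ) ≃+ ((A →+ Additive Eˣ) ⧸ augSub E A σ) :=
    (addCharEquiv _ _).trans (coinvariantsEquiv A σ E).symm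
  let e₄ := AddEquiv.prodCongr (N := Additive (AddChar (fixedAdd A σ) Eˣ))
    (N' := (A →+ Additive Eˣ) ⧸ augSub E A σ) (AddEquiv.refl (Additive (H2fixed A Eˣ σ))) e₃
  exact ⟨(groupCohomologyTwoEquivHQ Eˣ σ).trans (e₁.trans (e₂.trans e₄))⟩
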